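/- arXiv:1508.07512 — 4 statements merged into one kernel-verified Lean document; each statement's English description precedes it below -/
import Mathlib

section
/- The set H* is convex and compact. -/
open scoped BigOperators
open Filter Topology

noncomputable section

variable {I S : Type} [Fintype I] [DecidableEq I] [Fintype S]

/-- The configuration `e_i` consisting of a single type-`i` customer. -/
def econf (i : I) : I → ℕ := Pi.single i 1

/-- `K^s`: the set of nonzero configurations of server type `s`. -/
def Kc (Kbar : S → Finset (I → ℕ)) (s : S) : Finset (I → ℕ) := (Kbar s).erase 0

/-- Monotonicity of the configuration sets. -/
def KbarMono (Kbar : S → Finset (I → ℕ)) : Prop :=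
  ∀ s, ∀ k ∈ Kbar s, ∀ k' : I → ℕ, (∀ i, k' i ≤ k i) → k' ∈ Kbar s

/-- Each configuration set contains the zero configuration. -/
def KbarZero (Kbar : S → Finset (I → ℕ)) : Prop := ∀ s, (0 : I → ℕ) ∈ Kbar s

/-- Every customer type can be served by some server type. -/
def KbarServe (Kbar : S → Finset (I → ℕ)) : Prop := ∀ i : I, ∃ s, econf i ∈ Kbar s

/-- `ℝ_+^K`: nonnegative vectors supported on the nonzero configurations. -/
def orthK (Kbar : S → Finset (I → ℕ)) : Set (S → (I → ℕ) → ℝ) :=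
  {x | (∀ s k, 0 ≤ x s k) ∧ ∀ s, ∀ k, k ∉ Kc Kbar s → x s k = 0}

/-- The feasible set `X` (equality constraints). -/
def feasX (Kbar : S → Finset (I → ℕ)) (ρ : I → ℝ) : Set (S → (I → ℕ) → ℝ) :=
  {x | x ∈ orthK Kbar ∧ ∀ i, ∑ s, ∑ k ∈ Kc Kbar s, (k i : ℝ) * x s k = ρ i}

/-- The relaxed feasible set (inequality constraints). -/
def feasXge (Kbar : S → Finset (I → ℕ)) (ρ : I → ℝ) : Set (S → (I → ℕ) → ℝ) :=
  {x | x ∈ orthK Kbar ∧ ∀ i, ρ i ≤ ∑ s, ∑ k ∈ Kc Kbar s, (k i : ℝ) * x s k}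

/-- The weighted number of occupied servers. -/
def objW (Kbar : S → Finset (I → ℕ)) (γ : S → ℝ) (x : S → (I → ℕ) → ℝ) : ℝ :=
  ∑ s, ∑ k ∈ Kc Kbar s, γ s * x s k

/-- `X*`: optimal solutions of LP=. -/
def XstarSet (Kbar : S → Finset (I → ℕ)) (ρ : I → ℝ) (γ : S → ℝ) :
    Set (S → (I → ℕ) → ℝ) :=
  {x | x ∈ feasX Kbar ρ ∧ ∀ y ∈ feasX Kbar ρ, objW Kbar γ x ≤ objW Kbar γ y}

/-- `X**`: optimal solutions of LP≤. -/
def XstarSetGe (Kbar : S → Finset (I → ℕ)) (ρ : I → ℝ) (γ : S → ℝ) :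
    Set (S → (I → ℕ) → ℝ) :=
  {x | x ∈ feasXge Kbar ρ ∧ ∀ y ∈ feasXge Kbar ρ, objW Kbar γ x ≤ objW Kbar γ y}

/-- `H*`: dual optimal vectors. -/
def HstarSet (Kbar : S → Finset (I → ℕ)) (ρ : I → ℝ) (γ : S → ℝ) : Set (I → ℝ) :=
  {η | ∃ x ∈ feasX Kbar ρ, (∀ i, 0 ≤ η i) ∧
    (∀ s, ∀ k ∈ Kc Kbar s, ∑ i, (k i : ℝ) * η i ≤ γ s) ∧
    (∀ s, ∀ k ∈ Kc Kbar s, (∑ i, (k i : ℝ) * η i) < γ s → x s k = 0)}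

/-- `c_k = ∏_i k_i!`. -/
def ck (k : I → ℕ) : ℝ := ∏ i, (Nat.factorial (k i) : ℝ)

/-- The function `L^{(a)}`. -/
def Lfun (Kbar : S → Finset (I → ℕ)) (a : S → ℝ) (x : S → (I → ℕ) → ℝ) : ℝ :=
  ∑ s, ∑ k ∈ Kc Kbar s, x s k * Real.log (x s k * ck k / (Real.exp 1 * a s))

/-- Product form (infinite-server system). -/
def prodForm (Kbar : S → Finset (I → ℕ)) (a : S → ℝ) (x : S → (I → ℕ) → ℝ)
    (ν : I → ℝ) : Prop :=
  ∀ s, ∀ k ∈ Kc Kbar s, x s k = a s / ck k * Real.exp (∑ i, (k i : ℝ) * ν i)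

/-- ℓ¹ distance on the coordinates indexed by `K`. -/
def distK (Kbar : S → Finset (I → ℕ)) (x y : S → (I → ℕ) → ℝ) : ℝ :=
  ∑ s, ∑ k ∈ Kc Kbar s, |x s k - y s k|

/-- Extended coordinate value: the zero configuration of type `s` has value `a_s`. -/
def xval (a : S → ℝ) (x : S → (I → ℕ) → ℝ) (s : S) (k : I → ℕ) : ℝ :=
  if k = 0 then a s else x s k

/-- `x_{(i)}`: amount of servers available to a type-`i` arrival (GRAND(aZ)). -/
def xavail (Kbar : S → Finset (I → ℕ)) (a : S → ℝ) (x : S → (I → ℕ) → ℝ) (i : I) : ℝ :=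
  ∑ s, ((if econf i ∈ Kc Kbar s then a s else 0)
    + ∑ k ∈ (Kc Kbar s).filter (fun k => k + econf i ∈ Kbar s), x s k)

/-- Departure rate `w_{k i}`. -/
def wrate (μ : I → ℝ) (x : S → (I → ℕ) → ℝ) (s : S) (k : I → ℕ) (i : I) : ℝ :=
  (k i : ℝ) * μ i * x s k

/-- Arrival rate `v_{k i}` (GRAND(aZ)), with `λ_i = μ_i ρ_i`. -/
def vrate (Kbar : S → Finset (I → ℕ)) (a : S → ℝ) (μ ρ : I → ℝ)
    (x : S → (I → ℕ) → ℝ) (s : S) (k : I → ℕ) (i : I) : ℝ :=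
  μ i * ρ i * xval a x s (k - econf i) / xavail Kbar a x i

/-- The GRAND(aZ) fluid vector field `F_k(x)`, for `k ∈ K^s`. -/
def Fdrift (Kbar : S → Finset (I → ℕ)) (a : S → ℝ) (μ ρ : I → ℝ)
    (x : S → (I → ℕ) → ℝ) (s : S) (k : I → ℕ) : ℝ :=
  (∑ i ∈ Finset.univ.filter (fun i : I => 1 ≤ k i ∧ k - econf i ∈ Kbar s),
    (vrate Kbar a μ ρ x s k i - wrate μ x s k i))
  - ∑ i ∈ Finset.univ.filter (fun i : I => k + econf i ∈ Kbar s),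
    (vrate Kbar a μ ρ x s (k + econf i) i - wrate μ x s (k + econf i) i)

/-- The function `Ξ(x)` (GRAND(aZ)). -/
def Xi (Kbar : S → Finset (I → ℕ)) (a : S → ℝ) (μ : I → ℝ)
    (x : S → (I → ℕ) → ℝ) : ℝ :=
  ∑ i : I, ∑ s : S,
    ∑ k ∈ (Kc Kbar s).filter (fun k => 1 ≤ k i ∧ k - econf i ∈ Kbar s),
      ∑ s' : S,
        ∑ k' ∈ (Kc Kbar s').filter (fun k' => 1 ≤ k' i ∧ k' - econf i ∈ Kbar s'),
          (Real.log ((k' i : ℝ) * xval a x s (k - econf i) * x s' k')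
            - Real.log ((k i : ℝ) * x s k * xval a x s' (k' - econf i)))
          * ((k i : ℝ) * μ i * x s k * xval a x s' (k' - econf i) / xavail Kbar a x i)

open Classical in
/-- `Ξ` extended by `−∞` to points with a vanishing coordinate, as a map into `[−∞, 0] ⊆ EReal`. -/
def XiE (Kbar : S → Finset (I → ℕ)) (a : S → ℝ) (μ : I → ℝ)
    (x : S → (I → ℕ) → ℝ) : EReal :=
  if ∀ s, ∀ k ∈ Kc Kbar s, 0 < x s k then ((Xi Kbar a μ x : ℝ) : EReal) else ⊥

/-! Finite-server (GRAND-F) objects. -/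

/-- `X^□`. -/
def XBox (Kbar : S → Finset (I → ℕ)) (h : S → ℝ) : Set (S → (I → ℕ) → ℝ) :=
  {x | x ∈ orthK Kbar ∧ ∀ s, ∑ k ∈ Kc Kbar s, x s k ≤ h s}

/-- `x_{0^s} = h_s − Σ_{k∈K^s} x_k`. -/
def x0 (Kbar : S → Finset (I → ℕ)) (h : S → ℝ) (x : S → (I → ℕ) → ℝ) (s : S) : ℝ :=
  h s - ∑ k ∈ Kc Kbar s, x s k

/-- `X^⋄ = X^□ ∩ X`. -/
def XDiamond (Kbar : S → Finset (I → ℕ)) (h : S → ℝ) (ρ : I → ℝ) :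
    Set (S → (I → ℕ) → ℝ) := XBox Kbar h ∩ feasX Kbar ρ

/-- Assumption A: a feasible point with idle servers of every type. -/
def AssumptionA (Kbar : S → Finset (I → ℕ)) (h : S → ℝ) (ρ : I → ℝ) : Prop :=
  ∃ x ∈ XDiamond Kbar h ρ, ∀ s, 0 < x0 Kbar h x s

/-- The function `L^□`. -/
def LBox (Kbar : S → Finset (I → ℕ)) (h : S → ℝ) (x : S → (I → ℕ) → ℝ) : ℝ :=
  ∑ s, (x0 Kbar h x s * Real.log (x0 Kbar h x s / Real.exp 1)
    + ∑ k ∈ Kc Kbar s, x s k * Real.log (x s k * ck k / Real.exp 1))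

/-- Product form (finite-server system), including the zero configurations. -/
def prodFormBox (Kbar : S → Finset (I → ℕ)) (h : S → ℝ) (x : S → (I → ℕ) → ℝ)
    (ν : I → ℝ) (β : S → ℝ) : Prop :=
  ∀ s, x0 Kbar h x s = Real.exp (-β s) ∧
    ∀ k ∈ Kc Kbar s, x s k = Real.exp (-β s) / ck k * Real.exp (∑ i, (k i : ℝ) * ν i)

/-- Extended coordinate value for the finite-server system. -/
def xvalBox (Kbar : S → Finset (I → ℕ)) (h : S → ℝ) (x : S → (I → ℕ) → ℝ)
    (s : S) (k : I → ℕ) : ℝ :=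
  if k = 0 then x0 Kbar h x s else x s k

/-- `x_{(i)}` for the finite-server system (zero configurations included). -/
def xavailBox (Kbar : S → Finset (I → ℕ)) (h : S → ℝ) (x : S → (I → ℕ) → ℝ)
    (i : I) : ℝ :=
  ∑ s, ((if econf i ∈ Kc Kbar s then x0 Kbar h x s else 0)
    + ∑ k ∈ (Kc Kbar s).filter (fun k => k + econf i ∈ Kbar s), x s k)

/-- Arrival rate `v_{k i}` (GRAND-F), with `λ_i = μ_i ρ_i`. -/
def vrateBox (Kbar : S → Finset (I → ℕ)) (h : S → ℝ) (μ ρ : I → ℝ)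
    (x : S → (I → ℕ) → ℝ) (s : S) (k : I → ℕ) (i : I) : ℝ :=
  μ i * ρ i * xvalBox Kbar h x s (k - econf i) / xavailBox Kbar h x i

/-- The GRAND-F fluid vector field `F^□_k(x)`, for `k ∈ K^s`. -/
def FdriftBox (Kbar : S → Finset (I → ℕ)) (h : S → ℝ) (μ ρ : I → ℝ)
    (x : S → (I → ℕ) → ℝ) (s : S) (k : I → ℕ) : ℝ :=
  (∑ i ∈ Finset.univ.filter (fun i : I => 1 ≤ k i ∧ k - econf i ∈ Kbar s),
    (vrateBox Kbar h μ ρ x s k i - wrate μ x s k i))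
  - ∑ i ∈ Finset.univ.filter (fun i : I => k + econf i ∈ Kbar s),
    (vrateBox Kbar h μ ρ x s (k + econf i) i - wrate μ x s (k + econf i) i)

/-- The function `Ξ^□(x̄)`. -/
def XiBox (Kbar : S → Finset (I → ℕ)) (h : S → ℝ) (μ : I → ℝ)
    (x : S → (I → ℕ) → ℝ) : ℝ :=
  ∑ i : I, ∑ s : S,
    ∑ k ∈ (Kc Kbar s).filter (fun k => 1 ≤ k i ∧ k - econf i ∈ Kbar s),
      ∑ s' : S,
        ∑ k' ∈ (Kc Kbar s').filter (fun k' => 1 ≤ k' i ∧ k' - econf i ∈ Kbar s'),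
          (Real.log ((k' i : ℝ) * xvalBox Kbar h x s (k - econf i) * x s' k')
            - Real.log ((k i : ℝ) * x s k * xvalBox Kbar h x s' (k' - econf i)))
          * ((k i : ℝ) * μ i * x s k * xvalBox Kbar h x s' (k' - econf i)
              / xavailBox Kbar h x i)

/-- Exchanging the order of summation in `∑ (k · η) x_k` over a feasible point. -/
theorem sum_weight_mul_of_mem_feasX {Kbar : S → Finset (I → ℕ)} {ρ : I → ℝ}
    {x : S → (I → ℕ) → ℝ} (hx : x ∈ feasX Kbar ρ) (η : I → ℝ) :
    ∑ s, ∑ k ∈ Kc Kbar s, (∑ i, (k i : ℝ) * η i) * x s k = ∑ i, ρ i * η i := by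
  simp_rw [← hx.2, Finset.sum_mul]
  rw [Finset.sum_comm]
  refine Finset.sum_congr rfl fun s _ => ?_
  rw [Finset.sum_comm]
  exact Finset.sum_congr rfl fun k _ => Finset.sum_congr rfl fun i _ => by ring

/-- The duality gap is the total slackness. -/
theorem objW_sub_dual {Kbar : S → Finset (I → ℕ)} {ρ : I → ℝ}
    {x : S → (I → ℕ) → ℝ} (hx : x ∈ feasX Kbar ρ) (γ : S → ℝ) (η : I → ℝ) :
    objW Kbar γ x - ∑ i, ρ i * η i =
      ∑ s, ∑ k ∈ Kc Kbar s, (γ s - ∑ i, (k i : ℝ) * η i) * x s k := by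
  simp_rw [← sum_weight_mul_of_mem_feasX hx η, objW, sub_mul, Finset.sum_sub_distrib]

/-- Weak duality. -/
theorem dual_le_objW {Kbar : S → Finset (I → ℕ)} {ρ : I → ℝ}
    {x : S → (I → ℕ) → ℝ} (hx : x ∈ feasX Kbar ρ) {γ : S → ℝ} {η : I → ℝ}
    (hη : ∀ s, ∀ k ∈ Kc Kbar s, ∑ i, (k i : ℝ) * η i ≤ γ s) :
    ∑ i, ρ i * η i ≤ objW Kbar γ x := by
  rw [← sub_nonneg, objW_sub_dual hx]
  exact Finset.sum_nonneg fun s _ => Finset.sum_nonneg fun k hk =>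
    mul_nonneg (sub_nonneg.2 (hη s k hk)) (hx.1.1 s k)

/-- For a dual feasible vector, complementary slackness is the absence of a duality gap. -/
theorem slackness_iff_objW_le {Kbar : S → Finset (I → ℕ)} {ρ : I → ℝ}
    {x : S → (I → ℕ) → ℝ} (hx : x ∈ feasX Kbar ρ) {γ : S → ℝ} {η : I → ℝ}
    (hη : ∀ s, ∀ k ∈ Kc Kbar s, ∑ i, (k i : ℝ) * η i ≤ γ s) :
    (∀ s, ∀ k ∈ Kc Kbar s, (∑ i, (k i : ℝ) * η i) < γ s → x s k = 0) ↔
      objW Kbar γ x ≤ ∑ i, ρ i * η i := by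
  have hterm : ∀ s, ∀ k ∈ Kc Kbar s, 0 ≤ (γ s - ∑ i, (k i : ℝ) * η i) * x s k :=
    fun s k hk => mul_nonneg (sub_nonneg.2 (hη s k hk)) (hx.1.1 s k)
  have hsum : ∀ s ∈ Finset.univ,
      0 ≤ ∑ k ∈ Kc Kbar s, (γ s - ∑ i, (k i : ℝ) * η i) * x s k :=
    fun s _ => Finset.sum_nonneg (hterm s)
  rw [← sub_nonpos, objW_sub_dual hx]
  constructor
  · intro h
    refine (Finset.sum_eq_zero fun s _ => Finset.sum_eq_zero fun k hk => ?_).le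
    rcases (hη s k hk).lt_or_eq with hlt | heq
    · rw [h s k hk hlt, mul_zero]
    · rw [heq, sub_self, zero_mul]
  · intro h s k hk hlt
    have h₁ := (Finset.sum_eq_zero_iff_of_nonneg hsum).1
      (le_antisymm h (Finset.sum_nonneg hsum)) s (Finset.mem_univ s)
    have h₂ := (Finset.sum_eq_zero_iff_of_nonneg (hterm s)).1 h₁ k hk
    exact (mul_eq_zero.1 h₂).resolve_left (sub_pos.2 hlt).ne'

/-- If `x` is a feasible point complementary to some dual vector, then `H*` is the set of dual
feasible vectors whose dual value reaches the primal value of `x`. -/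
theorem HstarSet_eq_of_slackness {Kbar : S → Finset (I → ℕ)} {ρ : I → ℝ}
    {x : S → (I → ℕ) → ℝ} (hx : x ∈ feasX Kbar ρ) {γ : S → ℝ} {η : I → ℝ}
    (hη : ∀ s, ∀ k ∈ Kc Kbar s, ∑ i, (k i : ℝ) * η i ≤ γ s)
    (hslack : ∀ s, ∀ k ∈ Kc Kbar s, (∑ i, (k i : ℝ) * η i) < γ s → x s k = 0) :
    HstarSet Kbar ρ γ = {θ | (∀ i, 0 ≤ θ i) ∧
      (∀ s, ∀ k ∈ Kc Kbar s, ∑ i, (k i : ℝ) * θ i ≤ γ s) ∧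
      objW Kbar γ x ≤ ∑ i, ρ i * θ i} := by
  ext θ
  constructor
  · rintro ⟨y, hy, h0, hθ, hs⟩
    exact ⟨h0, hθ, ((slackness_iff_objW_le hx hη).1 hslack).trans <|
      (dual_le_objW hy hη).trans ((slackness_iff_objW_le hy hθ).1 hs)⟩
  · rintro ⟨h0, hθ, hle⟩
    exact ⟨x, hx, h0, hθ, (slackness_iff_objW_le hx hθ).2 hle⟩

/-- Dual feasible vectors are bounded. -/
theorem exists_dual_bound {Kbar : S → Finset (I → ℕ)} (hserve : KbarServe Kbar) (γ : S → ℝ) :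
    ∃ b : I → ℝ, ∀ η : I → ℝ,
      (∀ s, ∀ k ∈ Kc Kbar s, ∑ i, (k i : ℝ) * η i ≤ γ s) → ∀ i, η i ≤ b i := by
  choose s hs using hserve
  refine ⟨fun i => γ (s i), fun η hη i => ?_⟩
  have hmem : econf i ∈ Kc Kbar (s i) :=
    Finset.mem_erase.2 ⟨by simp [econf], hs i⟩
  simpa [econf, Pi.single_apply] using hη (s i) (econf i) hmem

/-- The set of dual feasible vectors with dual value at least `c` is convex. -/
theorem convex_dual_superlevel (Kbar : S → Finset (I → ℕ)) (ρ : I → ℝ) (γ : S → ℝ) (c : ℝ) :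
    Convex ℝ {θ : I → ℝ | (∀ i, 0 ≤ θ i) ∧
      (∀ s, ∀ k ∈ Kc Kbar s, ∑ i, (k i : ℝ) * θ i ≤ γ s) ∧ c ≤ ∑ i, ρ i * θ i} := by
  have hlin : ∀ w : I → ℝ, IsLinearMap ℝ fun θ : I → ℝ => ∑ i, w i * θ i := fun w =>
    ⟨fun θ θ' => dotProduct_add w θ θ', fun a θ => dotProduct_smul a w θ⟩
  simp only [Set.ofPred_and, Set.ofPred_forall]
  refine Convex.inter ?_ (Convex.inter ?_ (convex_halfSpace_ge (hlin ρ) c))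
  · exact convex_iInter fun i =>
      convex_halfSpace_ge (LinearMap.proj (R := ℝ) (φ := fun _ : I => ℝ) i).isLinear 0
  · exact convex_iInter fun s => convex_iInter fun k => convex_iInter fun _ =>
      convex_halfSpace_le (hlin fun i => (k i : ℝ)) (γ s)

/-- The set of dual feasible vectors with dual value at least `c` is closed. -/
theorem isClosed_dual_superlevel (Kbar : S → Finset (I → ℕ)) (ρ : I → ℝ) (γ : S → ℝ) (c : ℝ) :
    IsClosed {θ : I → ℝ | (∀ i, 0 ≤ θ i) ∧
      (∀ s, ∀ k ∈ Kc Kbar s, ∑ i, (k i : ℝ) * θ i ≤ γ s) ∧ c ≤ ∑ i, ρ i * θ i} := by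
  simp only [Set.ofPred_and, Set.ofPred_forall]
  refine (isClosed_iInter fun i => isClosed_le (by fun_prop) (by fun_prop)).inter
    ((isClosed_iInter fun s => isClosed_iInter fun k => isClosed_iInter fun _ =>
      isClosed_le (by fun_prop) (by fun_prop)).inter (isClosed_le (by fun_prop) (by fun_prop)))

/-- `H*` is convex and compact. -/
theorem Hstar_convex_compact
    (Kbar : S → Finset (I → ℕ))
    (hmono : KbarMono Kbar) (hzero : KbarZero Kbar) (hserve : KbarServe Kbar)
    (ρ : I → ℝ) (hρpos : ∀ i, 0 < ρ i) (hρsum : ∑ i, ρ i = 1)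
    (γ : S → ℝ) (hγpos : ∀ s, 0 < γ s) (s₁ : S) (hγ1 : γ s₁ = 1) :
    Convex ℝ (HstarSet Kbar ρ γ) ∧ IsCompact (HstarSet Kbar ρ γ) := by
  rcases (HstarSet Kbar ρ γ).eq_empty_or_nonempty with hempty | ⟨η, x, hx, -, hη, hslack⟩
  · rw [hempty]
    exact ⟨convex_empty, isCompact_empty⟩
  · rw [HstarSet_eq_of_slackness hx hη hslack]
    obtain ⟨b, hb⟩ := exists_dual_bound hserve γ
    exact ⟨convex_dual_superlevel Kbar ρ γ _,
      (isCompact_Icc (a := (0 : I → ℝ)) (b := b)).of_isClosed_subset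
        (isClosed_dual_superlevel Kbar ρ γ _) fun θ hθ => ⟨hθ.1, hb θ hθ.2.1⟩⟩
end
end

section
/- Every coordinate of the unique minimizer x^{*,a} of L^{(a)} over X is strictly positive: x^{*,a}_k > 0 for all k ∈ K. -/
open scoped BigOperators
open Filter Topology

noncomputable section

variable {I S : Type} [Fintype I] [DecidableEq I] [Fintype S]

open Classical in
/-- There is a feasible point all of whose coordinates indexed by `K` are strictly positive. -/
theorem exists_pos_mem_feasX
    (Kbar : S → Finset (I → ℕ)) (hserve : KbarServe Kbar)
    (ρ : I → ℝ) (hρpos : ∀ i, 0 < ρ i) :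
    ∃ z ∈ feasX Kbar ρ, ∀ s, ∀ k ∈ Kc Kbar s, 0 < z s k := by
  choose σ hσ using hserve
  have hmem : ∀ i, econf i ∈ Kc Kbar (σ i) := fun i =>
    Finset.mem_erase.2 ⟨by
      intro h
      have := congrFun h i
      simp [econf] at this, hσ i⟩
  let N : I → ℝ := fun i => ∑ s, ∑ k ∈ Kc Kbar s, (k i : ℝ)
  have hN : ∀ i, 0 ≤ N i := fun i => by positivity
  let T : ℝ := 1 + ∑ i, N i / ρ i
  have hTsum : ∀ i, N i / ρ i ≤ T := fun i => by
    have := Finset.single_le_sum (f := fun i => N i / ρ i)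
      (fun j _ => div_nonneg (hN j) (hρpos j).le) (Finset.mem_univ i)
    simp only [T]
    linarith
  have hT : 0 < T := by
    have : 0 ≤ ∑ i, N i / ρ i := Finset.sum_nonneg fun j _ => div_nonneg (hN j) (hρpos j).le
    simp only [T]
    linarith
  let δ : I → ℝ := fun i => ρ i - T⁻¹ * N i
  have hδ : ∀ i, 0 ≤ δ i := fun i => by
    have h := (div_le_iff₀ (hρpos i)).1 (hTsum i)
    have : T⁻¹ * N i ≤ ρ i := (inv_mul_le_iff₀ hT).2 h
    simp only [δ]
    linarith
  let w : S → (I → ℕ) → ℝ := fun s k =>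
    T⁻¹ + ∑ i, if s = σ i then (if k = econf i then δ i else 0) else 0
  have hw : ∀ s k, 0 < w s k := fun s k => by
    refine add_pos_of_pos_of_nonneg (inv_pos.2 hT) (Finset.sum_nonneg fun i _ => ?_)
    split_ifs
    exacts [hδ i, le_rfl, le_rfl]
  refine ⟨fun s k => if k ∈ Kc Kbar s then w s k else 0, ⟨⟨fun s k => ?_, fun s k hk => ?_⟩,
    fun j => ?_⟩, fun s k hk => ?_⟩
  · dsimp only
    split_ifs
    exacts [(hw s k).le, le_rfl]
  · simp [hk]
  · have h1 : ∀ s, ∑ k ∈ Kc Kbar s, (k j : ℝ) * (if k ∈ Kc Kbar s then w s k else 0)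
        = T⁻¹ * ∑ k ∈ Kc Kbar s, (k j : ℝ)
          + ∑ i, if s = σ i then (econf i j : ℝ) * δ i else 0 := fun s => by
      rw [Finset.mul_sum]
      have h2 : ∑ i, (if s = σ i then (econf i j : ℝ) * δ i else 0)
          = ∑ k ∈ Kc Kbar s, ∑ i,
            (k j : ℝ) * if s = σ i then (if k = econf i then δ i else 0) else 0 := by
        rw [Finset.sum_comm]
        refine Finset.sum_congr rfl fun i _ => ?_
        by_cases hs : s = σ i
        · subst hs
          simp [hmem i]
        · simp [hs]
      rw [h2, ← Finset.sum_add_distrib]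
      refine Finset.sum_congr rfl fun k hk => ?_
      simp only [hk, if_true, w]
      rw [mul_add, Finset.mul_sum, mul_comm]
    have h3 : ∑ s, ∑ i, (if s = σ i then (econf i j : ℝ) * δ i else 0) = δ j := by
      rw [Finset.sum_comm]
      simp [econf, Pi.single_apply]
    simp only [h1]
    rw [Finset.sum_add_distrib, h3, ← Finset.mul_sum]
    simp only [δ, N]
    ring
  · simpa [hk] using hw s k

/-- The feasible set is convex. -/
theorem convex_feasX (Kbar : S → Finset (I → ℕ)) (ρ : I → ℝ) : Convex ℝ (feasX Kbar ρ) := by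
  rintro x ⟨⟨hx0, hxK⟩, hxρ⟩ z ⟨⟨hz0, hzK⟩, hzρ⟩ p q hp hq hpq
  refine ⟨⟨fun s k => ?_, fun s k hk => ?_⟩, fun i => ?_⟩
  · have := hx0 s k
    have := hz0 s k
    simp only [Pi.add_apply, Pi.smul_apply, smul_eq_mul]
    positivity
  · simp [hxK s k hk, hzK s k hk]
  · have h : ∀ s, ∑ k ∈ Kc Kbar s, (k i : ℝ) * (p • x + q • z) s k
        = p * ∑ k ∈ Kc Kbar s, (k i : ℝ) * x s k
          + q * ∑ k ∈ Kc Kbar s, (k i : ℝ) * z s k := fun s => by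
      rw [Finset.mul_sum, Finset.mul_sum, ← Finset.sum_add_distrib]
      refine Finset.sum_congr rfl fun k _ => ?_
      simp only [Pi.add_apply, Pi.smul_apply, smul_eq_mul]
      ring
    simp only [h]
    rw [Finset.sum_add_distrib, ← Finset.mul_sum, ← Finset.mul_sum, hxρ, hzρ, ← add_mul, hpq,
      one_mul]

/-- For `C > 0`, the function `u ↦ u log (u C)` is convex on `[0, ∞)`. -/
theorem convexOn_mul_log_mul {C : ℝ} (hC : 0 < C) :
    ConvexOn ℝ (Set.Ici 0) fun u : ℝ => u * Real.log (u * C) := by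
  have h : ConvexOn ℝ (Set.Ici 0) fun u : ℝ => u * Real.log C :=
    ⟨convex_Ici 0, fun x _ y _ p q _ _ _ => by simp only [smul_eq_mul]; linarith⟩
  refine (Real.convexOn_mul_log.add h).congr fun u _ => ?_
  rcases eq_or_ne u 0 with rfl | hu
  · simp
  · simp only [Pi.add_apply]
    rw [Real.log_mul hu hC.ne']
    ring

/-- Along the segment from `0` to `z`, the function `u ↦ u log (u C)` has an extra term
`t z log t` compared with linear interpolation. -/
theorem mul_log_mul_smul {C t z : ℝ} (hC : 0 < C) (ht : 0 < t) (hz : 0 < z) :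
    t * z * Real.log (t * z * C) = t * (z * Real.log (z * C)) + t * (z * Real.log t) := by
  rw [mul_assoc t z C, Real.log_mul ht.ne' (mul_pos hz hC).ne']
  ring

/-- every coordinate of the minimizer `x^{*,a}` is strictly positive. -/
theorem minimizer_coords_pos
    (Kbar : S → Finset (I → ℕ))
    (hmono : KbarMono Kbar) (hzero : KbarZero Kbar) (hserve : KbarServe Kbar)
    (ρ : I → ℝ) (hρpos : ∀ i, 0 < ρ i) (hρsum : ∑ i, ρ i = 1)
    (a : S → ℝ) (hapos : ∀ s, 0 < a s)
    (xstar : S → (I → ℕ) → ℝ) (hxstar : xstar ∈ feasX Kbar ρ)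
    (hmin : ∀ y ∈ feasX Kbar ρ, Lfun Kbar a xstar ≤ Lfun Kbar a y) :
    ∀ s, ∀ k ∈ Kc Kbar s, 0 < xstar s k := by
  intro s₀ k₀ hk₀
  by_contra hneg
  have hx0 : xstar s₀ k₀ = 0 := le_antisymm (not_lt.1 hneg) (hxstar.1.1 s₀ k₀)
  obtain ⟨z, hz, hzpos⟩ := exists_pos_mem_feasX Kbar hserve ρ hρpos
  have hz₀ := hzpos s₀ k₀ hk₀
  let C : S → (I → ℕ) → ℝ := fun s k => ck k / (Real.exp 1 * a s)
  have hC : ∀ s k, 0 < C s k := fun s k =>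
    div_pos (Finset.prod_pos fun i _ => by exact_mod_cast Nat.factorial_pos _)
      (mul_pos (Real.exp_pos 1) (hapos s))
  have hL : ∀ x, Lfun Kbar a x
      = ∑ s, ∑ k ∈ Kc Kbar s, x s k * Real.log (x s k * C s k) := fun x => by
    simp only [Lfun, C, mul_div_assoc]
  classical
  have key : ∀ t : ℝ, 0 < t → t < 1 →
      0 ≤ Lfun Kbar a z - Lfun Kbar a xstar + z s₀ k₀ * Real.log t := by
    intro t ht ht1
    have hmem := convex_feasX Kbar ρ hxstar hz (sub_nonneg.2 ht1.le) ht.le (by ring)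
    have h := hmin _ hmem
    have hterm : ∀ s, ∀ k ∈ Kc Kbar s,
        ((1 - t) • xstar + t • z) s k * Real.log (((1 - t) • xstar + t • z) s k * C s k)
          ≤ (1 - t) * (xstar s k * Real.log (xstar s k * C s k))
            + t * (z s k * Real.log (z s k * C s k))
            + if s = s₀ then (if k = k₀ then t * (z s₀ k₀ * Real.log t) else 0) else 0 := by
      intro s k hk
      by_cases hs : s = s₀ ∧ k = k₀
      · obtain ⟨rfl, rfl⟩ := hs
        simp only [Pi.add_apply, Pi.smul_apply, smul_eq_mul, hx0, mul_zero, zero_mul, zero_add,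
          if_true]
        exact (mul_log_mul_smul (hC s k) ht hz₀).le
      · have := (convexOn_mul_log_mul (hC s k)).2 (hxstar.1.1 s k) (hz.1.1 s k)
          (sub_nonneg.2 ht1.le) ht.le (by ring)
        rw [← ite_and, if_neg hs, add_zero]
        simpa only [Pi.add_apply, Pi.smul_apply, smul_eq_mul] using this
    have hsum := Finset.sum_le_sum fun s (_ : s ∈ Finset.univ) =>
      Finset.sum_le_sum (hterm s)
    have hlast : ∑ s, ∑ k ∈ Kc Kbar s,
        (if s = s₀ then (if k = k₀ then t * (z s₀ k₀ * Real.log t) else 0) else 0)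
          = t * (z s₀ k₀ * Real.log t) := by
      rw [Finset.sum_eq_single s₀ (fun s _ hs => by simp [hs]) (by simp)]
      simp [hk₀]
    simp only [Finset.sum_add_distrib, ← Finset.mul_sum] at hsum
    rw [hlast, ← hL, ← hL, ← hL] at hsum
    have : 0 ≤ t * (Lfun Kbar a z - Lfun Kbar a xstar + z s₀ k₀ * Real.log t) := by
      linarith
    exact nonneg_of_mul_nonneg_right this ht
  have hM : 0 ≤ Lfun Kbar a z - Lfun Kbar a xstar := sub_nonneg.2 (hmin z hz)
  have h := key (Real.exp (-((Lfun Kbar a z - Lfun Kbar a xstar + 1) / z s₀ k₀)))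
    (Real.exp_pos _) (Real.exp_lt_one_iff.2 (neg_lt_zero.2 (by positivity)))
  rw [Real.log_exp, mul_neg, mul_div_cancel₀ _ hz₀.ne'] at h
  linarith
end
end

section
/- A point x ∈ X equals the unique minimizer x^{*,a} of L^{(a)} over X if and only if there exists a vector ν ∈ ℝ^I such that x has the product form x_k = (a_s/c_k)·exp(Σ_i k_i ν_i) for every s ∈ 𝓢 and every k ∈ K^s. Moreover, such a vector ν is unique, and for each i ∈ 𝓘 and any s with (e_i; s) ∈ K^s one has ν_i = log(x_{(e_i; s)}/a_s). -/
open scoped BigOperators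
open Filter Topology

noncomputable section

variable {I S : Type} [Fintype I] [DecidableEq I] [Fintype S]

/-- The relative entropy `∑ x_p (log (x_p / b_p) - 1)` with respect to the weights `b`. -/
def relEnt {ι : Type*} (P : Finset ι) (b x : ι → ℝ) : ℝ :=
  ∑ p ∈ P, x p * (Real.log (x p / b p) - 1)

lemma entropy_tangent_le {b x y : ℝ} (hb : 0 < b) (hx : 0 < x) (hy : 0 ≤ y) :
    x * (Real.log (x / b) - 1) + (y - x) * Real.log (x / b) ≤ y * (Real.log (y / b) - 1) := by
  rcases hy.eq_or_lt with rfl | hy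
  · linarith
  · have h := Real.log_le_sub_one_of_pos (div_pos hx hy)
    have h2 : y * Real.log (x / y) ≤ y * (x / y - 1) := mul_le_mul_of_nonneg_left h hy.le
    have h3 : y * (x / y - 1) = x - y := by field_simp
    rw [Real.log_div hx.ne' hy.ne', h3] at h2
    rw [Real.log_div hx.ne' hb.ne', Real.log_div hy.ne' hb.ne']
    nlinarith

lemma relEnt_tangent_le {ι : Type*} {P : Finset ι} {b x y : ι → ℝ} (hb : ∀ p ∈ P, 0 < b p)
    (hx : ∀ p ∈ P, 0 < x p) (hy : ∀ p ∈ P, 0 ≤ y p) :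
    relEnt P b x + ∑ p ∈ P, (y p - x p) * Real.log (x p / b p) ≤ relEnt P b y := by
  rw [relEnt, relEnt, ← Finset.sum_add_distrib]
  exact Finset.sum_le_sum fun p hp => entropy_tangent_le (hb p hp) (hx p hp) (hy p hp)

/-- A point minimizing the relative entropy on a segment towards an interior point is itself
interior. -/
lemma pos_of_relEnt_le_segment {ι : Type*} {P : Finset ι} {b x z : ι → ℝ}
    (hb : ∀ p ∈ P, 0 < b p) (hx : ∀ p ∈ P, 0 ≤ x p) (hz : ∀ p ∈ P, 0 < z p)
    (hmin : ∀ t : ℝ, 0 < t → t ≤ 1 → relEnt P b x ≤ relEnt P b (x + t • (z - x))) :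
    ∀ p ∈ P, 0 < x p := by
  classical
  intro q hq
  refine (hx q hq).lt_of_ne fun hxq => ?_
  have key : ∀ t : ℝ, 0 < t → t ≤ 1 →
      0 ≤ (∑ p ∈ P, (z p - x p) * Real.log (z p / b p)) + z q * Real.log t := by
    intro t ht ht1
    have hw : ∀ p, (x + t • (z - x)) p = (1 - t) * x p + t * z p := fun p => by
      simp only [Pi.add_apply, Pi.smul_apply, Pi.sub_apply, smul_eq_mul]; ring
    have hwpos : ∀ p ∈ P, 0 < (x + t • (z - x)) p := fun p hp => by
      rw [hw]
      have := mul_nonneg (sub_nonneg.2 ht1) (hx p hp)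
      have := mul_pos ht (hz p hp)
      linarith
    have h1 := relEnt_tangent_le hb hwpos hx
    have h2 := hmin t ht ht1
    have h3 : ∑ p ∈ P, (x p - (x + t • (z - x)) p) * Real.log ((x + t • (z - x)) p / b p) =
        -t * ∑ p ∈ P, (z p - x p) * Real.log ((x + t • (z - x)) p / b p) := by
      rw [Finset.mul_sum]
      refine Finset.sum_congr rfl fun p _ => ?_
      rw [hw]; ring
    have h4 : 0 ≤ ∑ p ∈ P, (z p - x p) * Real.log ((x + t • (z - x)) p / b p) := by
      rw [h3] at h1
      by_contra! hneg
      nlinarith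
    refine h4.trans ?_
    have h5 : z q * Real.log t = ∑ p ∈ P, if p = q then z q * Real.log t else 0 := by
      simp [hq]
    rw [h5, ← Finset.sum_add_distrib]
    refine Finset.sum_le_sum fun p hp => ?_
    split_ifs with hpq
    · subst hpq
      rw [hw, ← hxq, mul_zero, zero_add, mul_div_assoc,
        Real.log_mul ht.ne' (div_pos (hz p hp) (hb p hp)).ne']
      linarith
    · rw [add_zero, Real.log_div (hwpos p hp).ne' (hb p hp).ne',
        Real.log_div (hz p hp).ne' (hb p hp).ne']
      rcases le_total (x p) (z p) with h | h
      · refine mul_le_mul_of_nonneg_left (sub_le_sub_right ?_ _) (sub_nonneg.2 h)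
        refine Real.log_le_log (hwpos p hp) ?_
        rw [hw]; nlinarith
      · refine mul_le_mul_of_nonpos_left (sub_le_sub_right ?_ _) (sub_nonpos.2 h)
        refine Real.log_le_log (hz p hp) ?_
        rw [hw]; nlinarith
  set C := ∑ p ∈ P, (z p - x p) * Real.log (z p / b p)
  have hzq := hz q hq
  have := key (Real.exp (-((|C| + 1) / z q))) (Real.exp_pos _)
    (Real.exp_le_one_iff.2 (neg_nonpos.2 (by positivity)))
  rw [Real.log_exp, mul_neg, mul_div_cancel₀ _ hzq.ne'] at this
  linarith [le_abs_self C]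

/-- Stationarity of the relative entropy along a direction that stays feasible. -/
lemma relEnt_stationary {ι : Type*} {P : Finset ι} {b x d : ι → ℝ}
    (hb : ∀ p ∈ P, 0 < b p) (hx : ∀ p ∈ P, 0 < x p)
    (hmin : ∀ t : ℝ, (∀ p ∈ P, 0 ≤ (x + t • d) p) → relEnt P b x ≤ relEnt P b (x + t • d)) :
    ∑ p ∈ P, d p * Real.log (x p / b p) = 0 := by
  have hderiv : HasDerivAt (fun t : ℝ => relEnt P b (x + t • d))
      (∑ p ∈ P, d p * Real.log (x p / b p)) 0 := by
    unfold relEnt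
    refine HasDerivAt.fun_sum fun p hp => ?_
    have hxp := (hx p hp).ne'
    have hbp := (hb p hp).ne'
    have h1 : HasDerivAt (fun t : ℝ => x p + t * d p) (d p) 0 := by
      simpa using ((hasDerivAt_id (0 : ℝ)).mul_const (d p)).const_add (x p)
    have h2 := h1.mul (((h1.div_const (b p)).log (by simp [hxp, hbp])).sub_const 1)
    simp only [zero_mul, add_zero] at h2
    refine h2.congr_deriv ?_
    field_simp
    ring
  have hev : ∀ᶠ t in 𝓝 (0 : ℝ), ∀ p ∈ P, 0 ≤ (x + t • d) p := by
    rw [Filter.eventually_all_finset]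
    intro p hp
    have hc : Continuous fun t : ℝ => (x + t • d) p := by
      simp only [Pi.add_apply, Pi.smul_apply, smul_eq_mul]; fun_prop
    filter_upwards [hc.continuousAt.eventually_const_lt (u := 0) (by simpa using hx p hp)]
      with t ht using ht.le
  refine IsLocalMin.hasDerivAt_eq_zero ?_ hderiv
  filter_upwards [hev] with t ht
  simpa using hmin t ht

omit [DecidableEq I] in
lemma ck_pos (k : I → ℕ) : 0 < ck k :=
  Finset.prod_pos fun i _ => by exact_mod_cast Nat.factorial_pos _

/-- The pairs of a server type and a nonzero configuration of that type. -/
def confPairs (Kbar : S → Finset (I → ℕ)) : Finset (Σ _ : S, I → ℕ) :=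
  Finset.univ.sigma (Kc Kbar)

omit [DecidableEq I] in
lemma mem_confPairs {Kbar : S → Finset (I → ℕ)} {p : Σ _ : S, I → ℕ} :
    p ∈ confPairs Kbar ↔ p.2 ∈ Kc Kbar p.1 := by
  simp [confPairs]

omit [DecidableEq I] in
lemma sum_confPairs (Kbar : S → Finset (I → ℕ)) (f : (Σ _ : S, I → ℕ) → ℝ) :
    ∑ s, ∑ k ∈ Kc Kbar s, f ⟨s, k⟩ = ∑ p ∈ confPairs Kbar, f p :=
  (Finset.sum_sigma _ _ _).symm

omit [DecidableEq I] in
lemma Lfun_eq_relEnt (Kbar : S → Finset (I → ℕ)) {a : S → ℝ} (hapos : ∀ s, 0 < a s)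
    (x : S → (I → ℕ) → ℝ) :
    Lfun Kbar a x =
      relEnt (confPairs Kbar) (fun p => a p.1 / ck p.2) (fun p => x p.1 p.2) := by
  unfold Lfun relEnt
  rw [← sum_confPairs]
  refine Finset.sum_congr rfl fun s _ => Finset.sum_congr rfl fun k _ => ?_
  have ha := (hapos s).ne'
  have hc := (ck_pos k).ne'
  rcases eq_or_ne (x s k) 0 with h | h
  · simp [h]
  · rw [Real.log_div (mul_ne_zero h hc) (mul_ne_zero (Real.exp_pos 1).ne' ha),
      Real.log_mul h hc, Real.log_mul (Real.exp_pos 1).ne' ha, Real.log_exp,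
      Real.log_div h (div_ne_zero ha hc), Real.log_div ha hc]
    ring

omit [DecidableEq I] in
/-- Feasible points are preserved by balanced moves keeping all coordinates nonnegative. -/
lemma feasX_of_move {Kbar : S → Finset (I → ℕ)} {ρ : I → ℝ} {x : S → (I → ℕ) → ℝ}
    (hx : x ∈ feasX Kbar ρ) {w : (Σ _ : S, I → ℕ) → ℝ}
    (hw : ∀ p ∈ confPairs Kbar, 0 ≤ w p)
    (hbal : ∀ i, ∑ p ∈ confPairs Kbar, (p.2 i : ℝ) * (w p - x p.1 p.2) = 0) :
    ∃ y ∈ feasX Kbar ρ, ∀ p ∈ confPairs Kbar, y p.1 p.2 = w p := by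
  classical
  refine ⟨fun s k => if k ∈ Kc Kbar s then w ⟨s, k⟩ else 0, ⟨⟨fun s k => ?_, fun s k hk => ?_⟩,
    fun i => ?_⟩, fun p hp => ?_⟩
  · dsimp only
    split_ifs with h
    · exact hw _ (mem_confPairs.2 h)
    · exact le_rfl
  · simp [hk]
  · have h := hbal i
    simp only [mul_sub, Finset.sum_sub_distrib] at h
    rw [← sum_confPairs Kbar fun p => (p.2 i : ℝ) * x p.1 p.2, hx.2 i, sub_eq_zero] at h
    rw [← h, ← sum_confPairs]
    exact Finset.sum_congr rfl fun s _ => Finset.sum_congr rfl fun k hk => by simp [hk]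
  · simp [mem_confPairs.1 hp]

omit [Fintype I] in
lemma econf_apply (i j : I) : econf i j = if j = i then 1 else 0 := by
  simp [econf, Pi.single_apply]

omit [Fintype S] in
lemma econf_mem_Kc {Kbar : S → Finset (I → ℕ)} {i : I} {s : S} (h : econf i ∈ Kbar s) :
    econf i ∈ Kc Kbar s := by
  refine Finset.mem_erase.2 ⟨fun h0 => ?_, h⟩
  have := congrFun h0 i
  simp [econf] at this

lemma sum_mul_econf (g : I → ℝ) (i : I) : ∑ j, (econf i j : ℝ) * g j = g i := by
  simp [econf_apply]

omit [Fintype S] in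
lemma prodForm.eq_log {Kbar : S → Finset (I → ℕ)} {a : S → ℝ} (hapos : ∀ s, 0 < a s)
    {x : S → (I → ℕ) → ℝ} {ν : I → ℝ} (h : prodForm Kbar a x ν) {i : I} {s : S}
    (hi : econf i ∈ Kc Kbar s) : ν i = Real.log (x s (econf i) / a s) := by
  have hck : ck (econf i) = 1 := by
    refine Finset.prod_eq_one fun j _ => ?_
    rw [econf_apply]; split_ifs <;> simp
  rw [h s _ hi, hck, sum_mul_econf, div_one, mul_div_cancel_left₀ _ (hapos s).ne', Real.log_exp]

omit [DecidableEq I] in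
lemma prodForm.isMin {Kbar : S → Finset (I → ℕ)} {ρ : I → ℝ} {a : S → ℝ}
    (hapos : ∀ s, 0 < a s) {x : S → (I → ℕ) → ℝ} (hx : x ∈ feasX Kbar ρ) {ν : I → ℝ}
    (h : prodForm Kbar a x ν) {y : S → (I → ℕ) → ℝ} (hy : y ∈ feasX Kbar ρ) :
    Lfun Kbar a x ≤ Lfun Kbar a y := by
  have hb : ∀ p ∈ confPairs Kbar, 0 < a p.1 / ck p.2 := fun p _ =>
    div_pos (hapos _) (ck_pos _)
  have hform : ∀ p ∈ confPairs Kbar,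
      x p.1 p.2 = a p.1 / ck p.2 * Real.exp (∑ i, (p.2 i : ℝ) * ν i) := fun p hp =>
    h _ _ (mem_confPairs.1 hp)
  have hxpos : ∀ p ∈ confPairs Kbar, 0 < x p.1 p.2 := fun p hp => by
    rw [hform p hp]; exact mul_pos (hb p hp) (Real.exp_pos _)
  have hsum : ∑ p ∈ confPairs Kbar,
      (y p.1 p.2 - x p.1 p.2) * Real.log (x p.1 p.2 / (a p.1 / ck p.2)) = 0 := by
    calc _ = ∑ p ∈ confPairs Kbar, ∑ i,
            ν i * ((p.2 i : ℝ) * y p.1 p.2 - (p.2 i : ℝ) * x p.1 p.2) := by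
          refine Finset.sum_congr rfl fun p hp => ?_
          have hlog : Real.log (x p.1 p.2 / (a p.1 / ck p.2)) = ∑ i, (p.2 i : ℝ) * ν i := by
            rw [hform p hp, mul_div_cancel_left₀ _ (hb p hp).ne', Real.log_exp]
          rw [hlog, Finset.mul_sum]
          exact Finset.sum_congr rfl fun i _ => by ring
      _ = 0 := by
          rw [Finset.sum_comm]
          refine Finset.sum_eq_zero fun i _ => ?_
          rw [← Finset.mul_sum, Finset.sum_sub_distrib,
            ← sum_confPairs Kbar fun p => (p.2 i : ℝ) * y p.1 p.2,
            ← sum_confPairs Kbar fun p => (p.2 i : ℝ) * x p.1 p.2, hx.2 i, hy.2 i, sub_self,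
            mul_zero]
  have := relEnt_tangent_le (y := fun p => y p.1 p.2) hb hxpos fun p _ => hy.1.1 _ _
  rw [Lfun_eq_relEnt Kbar hapos, Lfun_eq_relEnt Kbar hapos]
  linarith

/-- There is an everywhere positive vector satisfying the balance constraints. -/
lemma exists_pos_balanced {Kbar : S → Finset (I → ℕ)} (hserve : KbarServe Kbar)
    {ρ : I → ℝ} (hρpos : ∀ i, 0 < ρ i) :
    ∃ z : (Σ _ : S, I → ℕ) → ℝ, (∀ p ∈ confPairs Kbar, 0 < z p) ∧
      ∀ i, ∑ p ∈ confPairs Kbar, (p.2 i : ℝ) * z p = ρ i := by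
  classical
  choose σ hσ using hserve
  let M : I → ℝ := fun i => ∑ p ∈ confPairs Kbar, (p.2 i : ℝ)
  have hev : ∀ᶠ ε in 𝓝[>] (0 : ℝ), 0 < ε ∧ ∀ i, 0 < ρ i - ε * M i := by
    refine (eventually_mem_nhdsWithin (a := (0 : ℝ)) (s := Set.Ioi 0)).and ?_
    rw [Filter.eventually_all]
    intro i
    refine nhdsWithin_le_nhds ?_
    have hc : Continuous fun ε : ℝ => ρ i - ε * M i := by fun_prop
    exact hc.continuousAt.eventually_const_lt (u := 0) (by simpa using hρpos i)
  obtain ⟨ε, hε, hεM⟩ := hev.exists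
  refine ⟨fun p => ε + ∑ i, if p = ⟨σ i, econf i⟩ then ρ i - ε * M i else 0, fun p _ => ?_,
    fun j => ?_⟩
  · refine add_pos_of_pos_of_nonneg hε (Finset.sum_nonneg fun i _ => ?_)
    split_ifs
    · exact (hεM i).le
    · exact le_rfl
  · simp only [mul_add, Finset.sum_add_distrib, Finset.mul_sum]
    rw [Finset.sum_comm, ← Finset.sum_mul]
    have hmem : ∀ i, (⟨σ i, econf i⟩ : Σ _ : S, I → ℕ) ∈ confPairs Kbar := fun i =>
      mem_confPairs.2 (econf_mem_Kc (hσ i))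
    simp only [mul_ite, mul_zero, Finset.sum_ite_eq', hmem, if_true, econf_apply]
    simp [M, mul_comm]

lemma exists_prodForm_of_isMin {Kbar : S → Finset (I → ℕ)} (hserve : KbarServe Kbar)
    {ρ : I → ℝ} (hρpos : ∀ i, 0 < ρ i) {a : S → ℝ} (hapos : ∀ s, 0 < a s)
    {x : S → (I → ℕ) → ℝ} (hx : x ∈ feasX Kbar ρ)
    (hmin : ∀ y ∈ feasX Kbar ρ, Lfun Kbar a x ≤ Lfun Kbar a y) :
    ∃ ν : I → ℝ, prodForm Kbar a x ν := by
  classical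
  set P := confPairs Kbar
  set b : (Σ _ : S, I → ℕ) → ℝ := fun p => a p.1 / ck p.2 with hbdef
  set u : (Σ _ : S, I → ℕ) → ℝ := fun p => x p.1 p.2
  have hb : ∀ p ∈ P, 0 < b p := fun p _ => div_pos (hapos _) (ck_pos _)
  have hent : ∀ w : (Σ _ : S, I → ℕ) → ℝ, (∀ p ∈ P, 0 ≤ w p) →
      (∀ i, ∑ p ∈ P, (p.2 i : ℝ) * (w p - u p) = 0) → relEnt P b u ≤ relEnt P b w := by
    intro w hw hbal
    obtain ⟨y, hy, hyw⟩ := feasX_of_move hx hw hbal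
    have h := hmin y hy
    rw [Lfun_eq_relEnt Kbar hapos, Lfun_eq_relEnt Kbar hapos] at h
    refine h.trans_eq (Finset.sum_congr rfl fun p hp => ?_)
    simp only [hyw p hp, hbdef]
  have hmove : ∀ d : (Σ _ : S, I → ℕ) → ℝ, (∀ i, ∑ p ∈ P, (p.2 i : ℝ) * d p = 0) →
      ∀ t : ℝ, (∀ p ∈ P, 0 ≤ (u + t • d) p) → relEnt P b u ≤ relEnt P b (u + t • d) := by
    intro d hd t ht
    refine hent _ ht fun i => ?_
    calc _ = t * ∑ p ∈ P, (p.2 i : ℝ) * d p := by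
          rw [Finset.mul_sum]
          refine Finset.sum_congr rfl fun p _ => ?_
          simp only [Pi.add_apply, Pi.smul_apply, smul_eq_mul]
          ring
      _ = 0 := by rw [hd i, mul_zero]
  have hupos : ∀ p ∈ P, 0 < u p := by
    obtain ⟨z, hz, hzbal⟩ := exists_pos_balanced hserve hρpos
    refine pos_of_relEnt_le_segment hb (fun p _ => hx.1.1 _ _) hz fun t ht ht1 =>
      hmove _ (fun i => ?_) t fun p hp => ?_
    · simp only [Pi.sub_apply, mul_sub, Finset.sum_sub_distrib]
      rw [hzbal i, ← sum_confPairs Kbar fun p => (p.2 i : ℝ) * u p, sub_eq_zero]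
      exact (hx.2 i).symm
    · have h1 : 0 ≤ (1 - t) * u p := mul_nonneg (sub_nonneg.2 ht1) (hx.1.1 _ _)
      have h2 := mul_pos ht (hz p hp)
      simp only [Pi.add_apply, Pi.smul_apply, Pi.sub_apply, smul_eq_mul]
      linarith
  choose σ hσ using hserve
  have hmem : ∀ i, (⟨σ i, econf i⟩ : Σ _ : S, I → ℕ) ∈ P := fun i =>
    mem_confPairs.2 (econf_mem_Kc (hσ i))
  refine ⟨fun i => Real.log (u ⟨σ i, econf i⟩ / b ⟨σ i, econf i⟩), fun s k hk => ?_⟩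
  have hq : (⟨s, k⟩ : Σ _ : S, I → ℕ) ∈ P := mem_confPairs.2 hk
  -- Trade one server in configuration `k` for `k i` servers in each configuration `econf i`.
  let d : (Σ _ : S, I → ℕ) → ℝ := fun p =>
    (if p = ⟨s, k⟩ then 1 else 0) - ∑ i, if p = ⟨σ i, econf i⟩ then (k i : ℝ) else 0
  have hd : ∀ g : (Σ _ : S, I → ℕ) → ℝ,
      ∑ p ∈ P, d p * g p = g ⟨s, k⟩ - ∑ i, (k i : ℝ) * g ⟨σ i, econf i⟩ := by
    intro g
    simp only [d, sub_mul, Finset.sum_sub_distrib, Finset.sum_mul]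
    rw [Finset.sum_comm]
    simp [hq, hmem]
  have hstat := relEnt_stationary hb hupos (hmove d fun j => by
    simp only [mul_comm _ (d _)]
    rw [hd fun p => (p.2 j : ℝ)]
    simp [econf_apply])
  rw [hd fun p => Real.log (u p / b p), sub_eq_zero] at hstat
  have hbq := hb _ hq
  rw [← hstat, Real.exp_log (div_pos (hupos _ hq) hbq)]
  exact (mul_div_cancel₀ (x s k) hbq.ne').symm

/-- product-form characterization of `x^{*,a}`, with uniqueness of `ν` and
`ν_i = log(x_{e_i}/a_s)`. -/
theorem minimizer_iff_product_form
    (Kbar : S → Finset (I → ℕ))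
    (hmono : KbarMono Kbar) (hzero : KbarZero Kbar) (hserve : KbarServe Kbar)
    (ρ : I → ℝ) (hρpos : ∀ i, 0 < ρ i) (hρsum : ∑ i, ρ i = 1)
    (a : S → ℝ) (hapos : ∀ s, 0 < a s)
    (x : S → (I → ℕ) → ℝ) (hx : x ∈ feasX Kbar ρ) :
    ((∀ y ∈ feasX Kbar ρ, Lfun Kbar a x ≤ Lfun Kbar a y) ↔
        ∃ ν : I → ℝ, prodForm Kbar a x ν) ∧
    (∀ ν ν' : I → ℝ, prodForm Kbar a x ν → prodForm Kbar a x ν' → ν = ν') ∧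
    (∀ ν : I → ℝ, prodForm Kbar a x ν →
      ∀ i s, econf i ∈ Kc Kbar s → ν i = Real.log (x s (econf i) / a s)) := by
  refine ⟨⟨exists_prodForm_of_isMin hserve hρpos hapos hx, ?_⟩, fun ν ν' h h' => ?_,
    fun ν h i s hi => h.eq_log hapos hi⟩
  · rintro ⟨ν, h⟩ y hy
    exact h.isMin hapos hx hy
  · funext i
    obtain ⟨s, hs⟩ := hserve i
    rw [h.eq_log hapos (econf_mem_Kc hs), h'.eq_log hapos (econf_mem_Kc hs)]
end
end

section
/- Let α_n ∈ (0,1) with α_n → 0, b_n = −log α_n, and a^{(n)}_s = α_n^{γ_s}. Let x^{*,a^{(n)}} be the unique minimizer of L^{(a^{(n)})} over X and ν^{*,a^{(n)}} ∈ ℝ^I the unique vector with x^{*,a^{(n)}}_k = (a^{(n)}_s/c_k)·exp(Σ_i k_i ν_i^{*,a^{(n)}}) for all k ∈ K^s, s ∈ 𝓢. Suppose x^{*,a^{(n)}} → x* for some x* ∈ X*. Then: (i) for every s ∈ 𝓢 and every k ∈ K^s, limsup_n Σ_i k_i ν_i^{*,a^{(n)}}/b_n ≤ γ_s; and (ii)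 for every i ∈ 𝓘, liminf_n ν_i^{*,a^{(n)}}/b_n ≥ 0. -/
open scoped BigOperators
open Filter Topology

noncomputable section

variable {I S : Type} [Fintype I] [DecidableEq I] [Fintype S]

lemma one_le_ck {J : Type} [Fintype J] (k : J → ℕ) : 1 ≤ ck k := by
  rw [ck, ← Nat.cast_prod, Nat.one_le_cast]
  exact Finset.prod_pos fun i _ => Nat.factorial_pos (k i)

lemma feasX_le_one {J T : Type} [Fintype J] [Fintype T]
    {Kbar : T → Finset (J → ℕ)} {ρ : J → ℝ} (hρpos : ∀ i, 0 < ρ i) (hρsum : ∑ i, ρ i = 1)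
    {x : T → (J → ℕ) → ℝ} (hx : x ∈ feasX Kbar ρ) {s : T} {k : J → ℕ} (hk : k ∈ Kc Kbar s) :
    x s k ≤ 1 := by
  obtain ⟨⟨hnonneg, -⟩, hsum⟩ := hx
  obtain ⟨i, hi⟩ : ∃ i, k i ≠ 0 := Function.ne_iff.mp (Finset.ne_of_mem_erase hk)
  have hki : (1 : ℝ) ≤ k i := by exact_mod_cast Nat.one_le_iff_ne_zero.mpr hi
  calc
    x s k ≤ k i * x s k := le_mul_of_one_le_left (hnonneg s k) hki
    _ ≤ ∑ k' ∈ Kc Kbar s, (k' i : ℝ) * x s k' :=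
      Finset.single_le_sum (f := fun k' : J → ℕ => (k' i : ℝ) * x s k')
        (fun k' _ => mul_nonneg (Nat.cast_nonneg _) (hnonneg s k')) hk
    _ ≤ ∑ t, ∑ k' ∈ Kc Kbar t, (k' i : ℝ) * x t k' :=
      Finset.single_le_sum (f := fun t => ∑ k' ∈ Kc Kbar t, (k' i : ℝ) * x t k')
        (fun t _ => Finset.sum_nonneg fun k' _ =>
          mul_nonneg (Nat.cast_nonneg _) (hnonneg t k')) (Finset.mem_univ s)
    _ = ρ i := hsum i
    _ ≤ ∑ j, ρ j := Finset.single_le_sum (fun j _ => (hρpos j).le) (Finset.mem_univ i)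
    _ = 1 := hρsum

lemma exists_pos_of_mem_feasX {J T : Type} [Fintype J] [Fintype T]
    {Kbar : T → Finset (J → ℕ)} {ρ : J → ℝ} {x : T → (J → ℕ) → ℝ} (hx : x ∈ feasX Kbar ρ)
    {i : J} (hi : 0 < ρ i) : ∃ s, ∃ k ∈ Kc Kbar s, 1 ≤ k i ∧ 0 < x s k := by
  rw [← hx.2 i] at hi
  obtain ⟨s, -, hs⟩ := Finset.exists_lt_of_sum_lt (Finset.sum_const_zero.trans_lt hi)
  obtain ⟨k, hk, hpos⟩ := Finset.exists_lt_of_sum_lt (Finset.sum_const_zero.trans_lt hs)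
  refine ⟨s, k, hk, Nat.one_le_iff_ne_zero.mpr ?_, ?_⟩
  · intro h0
    simp [h0] at hpos
  · exact pos_of_mul_pos_right hpos (Nat.cast_nonneg _)

/-- In product form with `a_s = α ^ γ_s`, every coordinate determines the corresponding linear
form in the dual variables. -/
lemma prodForm.sum_eq_log {J T : Type} [Fintype J] {Kbar : T → Finset (J → ℕ)}
    {α : ℝ} (hα : 0 < α) {γ : T → ℝ} {x : T → (J → ℕ) → ℝ} {ν : J → ℝ}
    (h : prodForm Kbar (fun s => α ^ γ s) x ν) {s : T} {k : J → ℕ} (hk : k ∈ Kc Kbar s) :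
    0 < x s k ∧
      ∑ i, (k i : ℝ) * ν i = Real.log (x s k) + Real.log (ck k) + γ s * (-Real.log α) := by
  have hc : 0 < ck k := one_pos.trans_le (one_le_ck k)
  have ha : 0 < α ^ γ s := Real.rpow_pos_of_pos hα _
  have hx := h s k hk
  refine ⟨by rw [hx]; positivity, ?_⟩
  rw [hx, Real.log_mul (by positivity) (Real.exp_pos _).ne', Real.log_exp,
    Real.log_div ha.ne' hc.ne', Real.log_rpow hα]
  ring

/-- along a sequence `α_n → 0`, if `x^{*,a^{(n)}} → x* ∈ X*`, then
(i) `limsup_n Σ_i k_i ν_i^{*,a^{(n)}}/b_n ≤ γ_s` for all `k ∈ K^s`, and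
(ii) `liminf_n ν_i^{*,a^{(n)}}/b_n ≥ 0` for all `i`
(stated via the equivalent eventual-bound formulations). -/
theorem dual_variables_limsup_liminf
    (Kbar : S → Finset (I → ℕ))
    (hmono : KbarMono Kbar) (hzero : KbarZero Kbar) (hserve : KbarServe Kbar)
    (ρ : I → ℝ) (hρpos : ∀ i, 0 < ρ i) (hρsum : ∑ i, ρ i = 1)
    (γ : S → ℝ) (hγpos : ∀ s, 0 < γ s) (s₁ : S) (hγ1 : γ s₁ = 1)
    (α : ℕ → ℝ) (hα : ∀ n, α n ∈ Set.Ioo (0 : ℝ) 1)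
    (hα0 : Tendsto α atTop (nhds 0))
    (xsel : ℕ → S → (I → ℕ) → ℝ) (νsel : ℕ → I → ℝ)
    (hxsel : ∀ n, xsel n ∈ feasX Kbar ρ ∧
      ∀ y ∈ feasX Kbar ρ,
        Lfun Kbar (fun s => α n ^ γ s) (xsel n) ≤ Lfun Kbar (fun s => α n ^ γ s) y)
    (hνsel : ∀ n, prodForm Kbar (fun s => α n ^ γ s) (xsel n) (νsel n))
    (xlim : S → (I → ℕ) → ℝ) (hxlim : xlim ∈ XstarSet Kbar ρ γ)
    (hconv : ∀ s k, Tendsto (fun n => xsel n s k) atTop (nhds (xlim s k))) :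
    (∀ s, ∀ k ∈ Kc Kbar s, ∀ ε > (0 : ℝ), ∀ᶠ n in atTop,
      (∑ i, (k i : ℝ) * νsel n i) / (-Real.log (α n)) ≤ γ s + ε) ∧
    (∀ i : I, ∀ ε > (0 : ℝ), ∀ᶠ n in atTop,
      -ε ≤ νsel n i / (-Real.log (α n))) := by
  have hb : Tendsto (fun n => -Real.log (α n)) atTop atTop :=
    tendsto_neg_atBot_atTop.comp (Real.tendsto_log_nhdsGT_zero.comp
      (tendsto_nhdsWithin_iff.mpr ⟨hα0, Eventually.of_forall fun n => (hα n).1⟩))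
  have hbpos : ∀ n, 0 < -Real.log (α n) := fun n =>
    neg_pos.mpr (Real.log_neg (hα n).1 (hα n).2)
  have hlarge : ∀ C : ℝ, ∀ ε > (0 : ℝ), ∀ᶠ n in atTop, C ≤ ε * (-Real.log (α n)) :=
    fun C ε hε => (hb.const_mul_atTop hε).eventually_ge_atTop C
  have hupper : ∀ s, ∀ k ∈ Kc Kbar s, ∀ ε > (0 : ℝ), ∀ᶠ n in atTop,
      ∑ i, (k i : ℝ) * νsel n i ≤ (γ s + ε) * (-Real.log (α n)) := by
    intro s k hk ε hε
    filter_upwards [hlarge (Real.log (ck k)) ε hε] with n hn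
    obtain ⟨hpos, hsum⟩ := (hνsel n).sum_eq_log (hα n).1 hk
    have hlog := Real.log_nonpos hpos.le (feasX_le_one hρpos hρsum (hxsel n).1 hk)
    linarith
  refine ⟨fun s k hk ε hε => ?_, fun i ε hε => ?_⟩
  · filter_upwards [hupper s k hk ε hε] with n hn
    exact (div_le_iff₀ (hbpos n)).mpr hn
  · obtain ⟨s, k, hk, hki, hlim⟩ := exists_pos_of_mem_feasX hxlim.1 (hρpos i)
    have hle : econf i ≤ k := by
      intro j
      by_cases hj : j = i
      · subst hj
        simpa [econf] using hki
      · simp [econf, hj]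
    have hrest : ∀ᶠ n in atTop,
        ∑ j, ((k - econf i) j : ℝ) * νsel n j ≤ (γ s + ε / 2) * (-Real.log (α n)) := by
      by_cases h0 : k - econf i = 0
      · refine Eventually.of_forall fun n => ?_
        simp only [h0, Pi.zero_apply, Nat.cast_zero, zero_mul, Finset.sum_const_zero]
        have := hγpos s
        exact mul_nonneg (by positivity) (hbpos n).le
      · exact hupper s _ (Finset.mem_erase.mpr ⟨h0, hmono s k (Finset.mem_of_mem_erase hk) _
          fun j => Nat.sub_le _ _⟩) _ (half_pos hε)
    filter_upwards [hrest, hlarge (-Real.log (xlim s k / 2)) _ (half_pos hε),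
      (hconv s k).eventually_const_lt (half_lt_self hlim)] with n hn hC hx
    have hsum := ((hνsel n).sum_eq_log (hα n).1 hk).2
    have hlog := Real.log_le_log (half_pos hlim) hx.le
    have hck := Real.log_nonneg (one_le_ck k)
    have hsplit : ∑ j, (k j : ℝ) * νsel n j
        = ∑ j, ((k - econf i) j : ℝ) * νsel n j + νsel n i := by
      have hei : ∑ j, (econf i j : ℝ) * νsel n j = νsel n i := by
        simp [econf, Pi.single_apply]
      rw [← hei, ← Finset.sum_add_distrib]
      refine Finset.sum_congr rfl fun j _ => ?_
      rw [← add_mul, ← Nat.cast_add, ← Pi.add_apply, tsub_add_cancel_of_le hle]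
    rw [le_div_iff₀ (hbpos n)]
    linarith
end
end
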